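/- Let n ≥ 2, let H(n) be the presented group defined above, and let Y = ⟨y_1,…,y_n⟩ ≤ H(n). Then for every a ∈ H(n) and all b, b' ∈ Y, both [[b,a],b'] = 1 and [[a,b],b'] = 1 hold in H(n). -/

import Mathlib

/-- The commutator `[g,h] = g⁻¹h⁻¹gh` (paper convention). -/
def gcomm {G : Type*} [Group G] (g h : G) : G := g⁻¹ * h⁻¹ * g * h

/-- The generator index set for `H(n)`: `Sum.inl i` is `x_i`, `Sum.inr j` is `y_j`. -/
abbrev HGen (n : ℕ) := Fin n ⊕ Fin n

/-- The word `x_i` in the free group. -/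
def xw {n : ℕ} (i : Fin n) : FreeGroup (HGen n) := FreeGroup.of (Sum.inl i)

/-- The word `y_j` in the free group. -/
def yw {n : ℕ} (j : Fin n) : FreeGroup (HGen n) := FreeGroup.of (Sum.inr j)

/-- The word `z` in the free group, for a generator `z`. -/
def zw {n : ℕ} (z : HGen n) : FreeGroup (HGen n) := FreeGroup.of z

/-- The relators of the presentation of `H(n)`. -/
def HRels (n : ℕ) : Set (FreeGroup (HGen n)) :=
  {w | ∃ z, w = zw z ^ 2} ∪
  {w | ∃ i j, w = gcomm (xw i) (xw j)} ∪
  {w | ∃ i j, w = gcomm (yw i) (yw j)} ∪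
  {w | ∃ i j, w = gcomm (xw i) (yw j) ^ 2} ∪
  {w | ∃ i j k, w = gcomm (gcomm (yw j) (xw i)) (yw k)} ∪
  {w | ∃ i j z, w = gcomm (gcomm (xw i) (yw j)) (zw z) ^ 2} ∪
  {w | ∃ z₁ z₂ z₃ z₄, w = gcomm (gcomm (gcomm (zw z₁) (zw z₂)) (zw z₃)) (zw z₄)}

/-- The group `H(n)` defined by the presentation. -/
abbrev Hn (n : ℕ) := PresentedGroup (HRels n)

/-- The image of the generator `x_i` in `H(n)`. -/
def xH {n : ℕ} (i : Fin n) : Hn n := PresentedGroup.of (Sum.inl i)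

/-- The image of the generator `y_j` in `H(n)`. -/
def yH {n : ℕ} (j : Fin n) : Hn n := PresentedGroup.of (Sum.inr j)

/-- The subgroup `X = ⟨x_1, …, x_n⟩` of `H(n)`. -/
def XH (n : ℕ) : Subgroup (Hn n) := Subgroup.closure (Set.range (xH (n := n)))

/-- The subgroup `Y = ⟨y_1, …, y_n⟩` of `H(n)`. -/
def YH (n : ℕ) : Subgroup (Hn n) := Subgroup.closure (Set.range (yH (n := n)))

theorem aux_right {G : Type*} [Group G] (N : Subgroup G) [hN : N.Normal] (S : Set G) (T : Subgroup G)
    (hT : T = Subgroup.closure S) (g : G) (h : ∀ s ∈ S, gcomm g s ∈ N) (k : G) (hk : k ∈ T) :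
    gcomm g k ∈ N := by
  subst hT
  induction hk using Subgroup.closure_induction with
  | mem x hx => exact h x hx
  | one => simp [gcomm]
  | mul x y _ _ hx hy =>
    have := N.mul_mem hy (hN.conj_mem _ hx y⁻¹)
    convert this using 1
    simp only [gcomm]; group
  | inv x _ hx =>
    have := hN.conj_mem _ (N.inv_mem hx) x
    convert this using 1
    simp only [gcomm]; group

theorem aux_swap {G : Type*} [Group G] (N : Subgroup G) (g h : G) (hh : gcomm g h ∈ N) :
    gcomm h g ∈ N := by
  have := N.inv_mem hh
  convert this using 1
  simp only [gcomm]; group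

theorem aux_ucs {G : Type*} [Group G] (m : ℕ) (g : G) :
    g ∈ Subgroup.upperCentralSeries G (m+1) ↔ ∀ h, gcomm g h ∈ Subgroup.upperCentralSeries G m := by
  rw [← inv_mem_iff, Subgroup.mem_upperCentralSeries_succ_iff]
  constructor
  · intro H h
    have := H h⁻¹
    simpa [gcomm, commutatorElement_def] using this
  · intro H h
    have := H h⁻¹
    simpa [gcomm, commutatorElement_def] using this

theorem aux_step {G : Type*} [Group G] (S : Set G) (hS : Subgroup.closure S = ⊤) (m : ℕ) (g : G)
    (h : ∀ s ∈ S, gcomm g s ∈ Subgroup.upperCentralSeries G m) :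
    g ∈ Subgroup.upperCentralSeries G (m+1) :=
  (aux_ucs m g).2 fun k => aux_right _ S ⊤ hS.symm g h k trivial

theorem aux_class {G : Type*} [Group G] (S : Set G) (hS : Subgroup.closure S = ⊤)
    (h4 : ∀ a ∈ S, ∀ b ∈ S, ∀ c ∈ S, ∀ d ∈ S, gcomm (gcomm (gcomm a b) c) d = 1) (g h k l : G) :
    Commute (gcomm (gcomm g h) k) l := by
  have h2 : ∀ a ∈ S, ∀ b ∈ S, gcomm a b ∈ Subgroup.upperCentralSeries G 2 := fun a ha b hb =>
    aux_step S hS 1 _ fun c hc => aux_step S hS 0 _ fun d hd => by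
      simp [h4 a ha b hb c hc d hd]
  have h3 : ∀ a ∈ S, ∀ b, gcomm a b ∈ Subgroup.upperCentralSeries G 2 := fun a ha b =>
    aux_right _ S ⊤ hS.symm a (h2 a ha) b trivial
  have h5 : gcomm g h ∈ Subgroup.upperCentralSeries G 2 :=
    aux_right _ S ⊤ hS.symm g (fun s hs => aux_swap _ _ _ (h3 s hs g)) h trivial
  have h6 := (aux_ucs 0 _).1 ((aux_ucs 1 _).1 h5 k) l
  simp only [Subgroup.upperCentralSeries_zero, Subgroup.mem_bot] at h6
  generalize gcomm (gcomm g h) k = u at h6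
  simp only [gcomm] at h6
  have : u⁻¹ * l⁻¹ * u * l = (l * u)⁻¹ * (u * l) := by group
  rw [this, inv_mul_eq_one] at h6
  exact h6.symm

theorem gcomm_eq_one_iff' {G : Type*} [Group G] (u l : G) : gcomm u l = 1 ↔ Commute u l := by
  have : gcomm u l = (l * u)⁻¹ * (u * l) := by simp only [gcomm]; group
  rw [this, inv_mul_eq_one]
  exact eq_comm

theorem rel_one {n : ℕ} {w : FreeGroup (HGen n)} (h : w ∈ HRels n) :
    PresentedGroup.mk (HRels n) w = 1 := PresentedGroup.one_of_mem h

theorem mk_gcomm {n : ℕ} (u v : FreeGroup (HGen n)) :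
    PresentedGroup.mk (HRels n) (gcomm u v) =
      gcomm (PresentedGroup.mk (HRels n) u) (PresentedGroup.mk (HRels n) v) := by
  simp [gcomm]

theorem Hn_class {n : ℕ} (g h k l : Hn n) : Commute (gcomm (gcomm g h) k) l := by
  refine aux_class (Set.range (PresentedGroup.of (rels := HRels n)))
    (PresentedGroup.closure_range_of _) ?_ g h k l
  rintro _ ⟨a, rfl⟩ _ ⟨b, rfl⟩ _ ⟨c, rfl⟩ _ ⟨d, rfl⟩
  have := rel_one (n := n) (w := gcomm (gcomm (gcomm (zw a) (zw b)) (zw c)) (zw d))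
    (Or.inr ⟨a, b, c, d, rfl⟩)
  simp only [mk_gcomm] at this
  exact this

theorem Hn_conj {n : ℕ} (g h k l : Hn n) (H : Commute (gcomm g h) l) :
    Commute (k⁻¹ * gcomm g h * k) l := by
  have : k⁻¹ * gcomm g h * k = gcomm g h * gcomm (gcomm g h) k := by
    generalize gcomm g h = u
    simp only [gcomm]; group
  rw [this]
  exact H.mul_left (Hn_class g h k l)

theorem Hn_gen {n : ℕ} (z : HGen n) (j k : Fin n) :
    Commute (gcomm (PresentedGroup.of z : Hn n) (yH j)) (yH k) := by
  rcases z with i | i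
  · have := rel_one (n := n) (w := gcomm (gcomm (yw j) (xw i)) (yw k))
      (Or.inl (Or.inl (Or.inr ⟨i, j, k, rfl⟩)))
    simp only [mk_gcomm] at this
    have h2 := ((gcomm_eq_one_iff' _ _).1 this).inv_left
    have e : ∀ u v : Hn n, gcomm u v = (gcomm v u)⁻¹ := by
      intro u v; simp only [gcomm]; group
    rw [e]
    exact h2
  · have := rel_one (n := n) (w := gcomm (yw i) (yw j))
      (Or.inl (Or.inl (Or.inl (Or.inl (Or.inr ⟨i, j, rfl⟩)))))
    simp only [mk_gcomm] at this
    have h2 : gcomm (PresentedGroup.of (Sum.inr i) : Hn n) (yH j) = 1 := this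
    rw [h2]
    exact Commute.one_left _

theorem Hn_all {n : ℕ} (a b b' : Hn n) (hb : b ∈ YH n) (hb' : b' ∈ YH n) :
    Commute (gcomm a b) b' := by
  unfold YH at hb hb'
  induction hb' using Subgroup.closure_induction with
  | one => exact Commute.one_right _
  | mul x y _ _ hx hy => exact hx.mul_right hy
  | inv x _ hx => exact hx.inv_right
  | mem x hx =>
    obtain ⟨k, rfl⟩ := hx
    induction hb using Subgroup.closure_induction with
    | one => simp [gcomm]
    | mul x y _ _ hx hy =>
      have : gcomm a (x * y) = gcomm a y * (y⁻¹ * gcomm a x * y) := by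
        simp only [gcomm]; group
      rw [this]
      exact hy.mul_left (Hn_conj _ _ _ _ hx)
    | inv x _ hx =>
      have : gcomm a x⁻¹ = ((x⁻¹)⁻¹ * gcomm a x * x⁻¹)⁻¹ := by
        simp only [gcomm]; group
      rw [this]
      exact (Hn_conj _ _ _ _ hx).inv_left
    | mem x hx =>
      obtain ⟨j, rfl⟩ := hx
      have ha : a ∈ Subgroup.closure (Set.range (PresentedGroup.of (rels := HRels n))) := by
        rw [PresentedGroup.closure_range_of]; trivial
      induction ha using Subgroup.closure_induction with
      | one => simp [gcomm]
      | mul x y _ _ hx hy =>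
        have : gcomm (x * y) (yH j) = (y⁻¹ * gcomm x (yH j) * y) * gcomm y (yH j) := by
          simp only [gcomm]; group
        rw [this]
        exact (Hn_conj _ _ _ _ hx).mul_left hy
      | inv x _ hx =>
        have : gcomm x⁻¹ (yH j) = ((x⁻¹)⁻¹ * gcomm x (yH j) * x⁻¹)⁻¹ := by
          simp only [gcomm]; group
        rw [this]
        exact (Hn_conj _ _ _ _ hx).inv_left
      | mem x hx =>
        obtain ⟨z, rfl⟩ := hx
        exact Hn_gen z j k

/-- For every `a ∈ H(n)` and all `b, b' ∈ Y`, both `[[b,a],b'] = 1` and `[[a,b],b'] = 1`. -/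
theorem statement17 (n : ℕ) (hn : 2 ≤ n) (a b b' : Hn n)
    (hb : b ∈ YH n) (hb' : b' ∈ YH n) :
    gcomm (gcomm b a) b' = 1 ∧ gcomm (gcomm a b) b' = 1 := by
  have h := Hn_all a b b' hb hb'
  refine ⟨(gcomm_eq_one_iff' _ _).2 ?_, (gcomm_eq_one_iff' _ _).2 h⟩
  have e : gcomm b a = (gcomm a b)⁻¹ := by
    simp only [gcomm]; group
  rw [e]
  exact h.inv_left
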